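/- Let λ₁, λ₂ ∈ ℝ with λ₁·λ₂ > 0 and let u : ℝ × ℝⁿ → ℂ be a smooth solution of the cubic-quintic NLS i∂_t u + Δ_x u = λ₁|u|²u - λ₂|u|⁴u which is exponentially localized (there exist C, γ > 0 with |∂^α u(t,x)| ≤ C e^{-γ|x|} for all (t,x) and all space-time derivatives ∂^α of order at most 2), is time-periodic with some period T > 0, and has zero momentum P[u](0) = 0. If either (1) n = 1 and λ₁·E₁[u] ≤ 0, or (2) n = 2 and λ₂·E₁[u] ≤ 0, then u is identically zero. -/

import Mathlib

open MeasureTheory Real Complex Function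

/-- Partial derivative in the `j`-th coordinate direction. -/
noncomputable def pd {n : ℕ} (f : EuclideanSpace ℝ (Fin n) → ℂ) (j : Fin n)
    (x : EuclideanSpace ℝ (Fin n)) : ℂ :=
  fderiv ℝ f x (EuclideanSpace.single j 1)

/-- Spatial Laplacian. -/
noncomputable def lap {n : ℕ} (f : EuclideanSpace ℝ (Fin n) → ℂ)
    (x : EuclideanSpace ℝ (Fin n)) : ℂ :=
  ∑ j, pd (fun y => pd f j y) j x

/-- Energy of the cubic-quintic NLS (at `t = 0`):
`E₁[u] = ∫ (|∇u|² + (λ₁/2)|u|⁴ - (λ₂/3)|u|⁶) dx`. -/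
noncomputable def energyCQ {n : ℕ} (lam1 lam2 : ℝ)
    (u : ℝ → EuclideanSpace ℝ (Fin n) → ℂ) : ℝ :=
  ∫ x, ((∑ j, ‖pd (u 0) j x‖ ^ 2)
    + (lam1 / 2) * ‖u 0 x‖ ^ 4 - (lam2 / 3) * ‖u 0 x‖ ^ 6)

/-- Functions on spacetime `ℝ × E` decaying faster than any power of `‖x‖`, uniformly in time. -/
def RapidDecay {E V : Type*} [NormedAddCommGroup E] [NormedAddCommGroup V] (F : ℝ × E → V) :
    Prop :=
  ∀ N : ℕ, ∃ K : ℝ, ∀ z, (1 + ‖z.2‖) ^ N * ‖F z‖ ≤ K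

namespace RapidDecay

variable {E V W : Type*} [NormedAddCommGroup E] [NormedAddCommGroup V] [NormedAddCommGroup W]

lemma mono {F : ℝ × E → V} {G : ℝ × E → W} (hF : RapidDecay F) (h : ∀ z, ‖G z‖ ≤ ‖F z‖) :
    RapidDecay G := fun N => by
  obtain ⟨K, hK⟩ := hF N
  exact ⟨K, fun z => (mul_le_mul_of_nonneg_left (h z) (by positivity)).trans (hK z)⟩

lemma norm {F : ℝ × E → V} (hF : RapidDecay F) : RapidDecay fun z => ‖F z‖ :=
  hF.mono fun z => by simp

lemma add {F G : ℝ × E → V} (hF : RapidDecay F) (hG : RapidDecay G) :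
    RapidDecay fun z => F z + G z := fun N => by
  obtain ⟨K, hK⟩ := hF N
  obtain ⟨L, hL⟩ := hG N
  refine ⟨K + L, fun z => le_trans ?_ (add_le_add (hK z) (hL z))⟩
  rw [← mul_add]
  exact mul_le_mul_of_nonneg_left (norm_add_le _ _) (by positivity)

lemma const_mul {F : ℝ × E → ℝ} (hF : RapidDecay F) (c : ℝ) : RapidDecay fun z => c * F z :=
  fun N => by
  obtain ⟨K, hK⟩ := hF N
  refine ⟨|c| * K, fun z => ?_⟩
  rw [norm_mul, Real.norm_eq_abs, mul_left_comm]
  exact mul_le_mul_of_nonneg_left (hK z) (abs_nonneg c)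

lemma mul {F G : ℝ × E → ℝ} (hF : RapidDecay F) (hG : RapidDecay G) :
    RapidDecay fun z => F z * G z := fun N => by
  obtain ⟨K, hK⟩ := hF N
  obtain ⟨L, hL⟩ := hG 0
  refine ⟨K * L, fun z => ?_⟩
  have h := hL z
  rw [pow_zero, one_mul] at h
  rw [norm_mul, ← mul_assoc]
  exact mul_le_mul (hK z) h (norm_nonneg _) ((by positivity : (0 : ℝ) ≤ _).trans (hK z))

lemma norm_snd_mul {F : ℝ × E → ℝ} (hF : RapidDecay F) : RapidDecay fun z => ‖z.2‖ * F z :=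
  fun N => by
  obtain ⟨K, hK⟩ := hF (N + 1)
  refine ⟨K, fun z => le_trans ?_ (hK z)⟩
  rw [norm_mul, norm_norm, pow_succ, mul_assoc]
  gcongr
  linarith

lemma of_exp_bound {F : ℝ × E → V} {C γ : ℝ} (hγ : 0 < γ)
    (h : ∀ z, ‖F z‖ ≤ C * Real.exp (-γ * ‖z.2‖)) : RapidDecay F := fun N => by
  refine ⟨N.factorial / γ ^ N * Real.exp γ * C, fun z => ?_⟩
  have h1 := Real.pow_div_factorial_le_exp (γ * (1 + ‖z.2‖)) (by positivity) N
  have h2 : (1 + ‖z.2‖) ^ N ≤ N.factorial / γ ^ N * Real.exp (γ * (1 + ‖z.2‖)) := by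
    rw [div_le_iff₀ (by positivity), mul_pow] at h1
    rw [div_mul_eq_mul_div, le_div_iff₀ (by positivity)]
    linarith
  calc (1 + ‖z.2‖) ^ N * ‖F z‖
      ≤ (N.factorial / γ ^ N * Real.exp (γ * (1 + ‖z.2‖))) * (C * Real.exp (-γ * ‖z.2‖)) := by
        gcongr
        exact h z
    _ = N.factorial / γ ^ N * (Real.exp (γ * (1 + ‖z.2‖)) * Real.exp (-γ * ‖z.2‖)) * C := by ring
    _ = _ := by rw [← Real.exp_add]; ring_nf

lemma exists_integrable_bound [NormedSpace ℝ E] [FiniteDimensional ℝ E] [MeasureSpace E]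
    [BorelSpace E] [(volume : Measure E).IsAddHaarMeasure] {F : ℝ × E → V} (hF : RapidDecay F) :
    ∃ b : E → ℝ, Integrable b ∧ ∀ t x, ‖F (t, x)‖ ≤ b x := by
  obtain ⟨K, hK⟩ := hF (Module.finrank ℝ E + 1)
  refine ⟨fun x => K * (1 + ‖x‖) ^ (-((Module.finrank ℝ E + 1 : ℕ) : ℝ)),
    (integrable_one_add_norm (by push_cast; linarith)).const_mul K, fun t x => ?_⟩
  have hx : 0 < 1 + ‖x‖ := by positivity
  change _ ≤ K * (1 + ‖x‖) ^ (-((Module.finrank ℝ E + 1 : ℕ) : ℝ))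
  rw [Real.rpow_neg hx.le, Real.rpow_natCast, ← div_eq_mul_inv, le_div_iff₀ (by positivity),
    mul_comm]
  exact hK (t, x)

end RapidDecay

/-- Continuously differentiable functions on spacetime, rapidly decaying with their gradient. -/
structure RapidC1 {E : Type*} [NormedAddCommGroup E] [NormedSpace ℝ E] (F : ℝ × E → ℝ) :
    Prop where
  contDiff : ContDiff ℝ 1 F
  decay : RapidDecay F
  decay_fderiv : RapidDecay (fderiv ℝ F)

namespace RapidC1

section Closure

variable {E : Type*} [NormedAddCommGroup E] [NormedSpace ℝ E] {F G : ℝ × E → ℝ}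

lemma differentiable (hF : RapidC1 F) : Differentiable ℝ F :=
  hF.contDiff.differentiable one_ne_zero

lemma add (hF : RapidC1 F) (hG : RapidC1 G) : RapidC1 fun z => F z + G z where
  contDiff := hF.contDiff.add hG.contDiff
  decay := hF.decay.add hG.decay
  decay_fderiv := (hF.decay_fderiv.add hG.decay_fderiv).mono fun z => by
    rw [fderiv_fun_add (hF.differentiable z) (hG.differentiable z)]

lemma const_mul (hF : RapidC1 F) (c : ℝ) : RapidC1 fun z => c * F z where
  contDiff := contDiff_const.mul hF.contDiff
  decay := hF.decay.const_mul c
  decay_fderiv := (hF.decay_fderiv.norm.const_mul c).mono fun z => by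
    rw [fderiv_const_mul (hF.differentiable z), norm_smul, norm_mul, norm_norm]

lemma neg (hF : RapidC1 F) : RapidC1 fun z => -F z := by
  simpa using hF.const_mul (-1)

lemma sub (hF : RapidC1 F) (hG : RapidC1 G) : RapidC1 fun z => F z - G z := by
  simpa [sub_eq_add_neg] using hF.add hG.neg

lemma mul (hF : RapidC1 F) (hG : RapidC1 G) : RapidC1 fun z => F z * G z where
  contDiff := hF.contDiff.mul hG.contDiff
  decay := hF.decay.mul hG.decay
  decay_fderiv := by
    refine ((hF.decay.norm.mul hG.decay_fderiv.norm).add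
      (hG.decay.norm.mul hF.decay_fderiv.norm)).mono fun z => ?_
    rw [fderiv_fun_mul (hF.differentiable z) (hG.differentiable z)]
    refine (norm_add_le _ _).trans ?_
    rw [norm_smul, norm_smul]
    exact le_abs_self _

lemma pow (hF : RapidC1 F) : ∀ m : ℕ, RapidC1 fun z => F z ^ (m + 1)
  | 0 => by simpa using hF
  | m + 1 => by simpa only [pow_succ] using (hF.pow m).mul hF

lemma zero : RapidC1 fun _ : ℝ × E => (0 : ℝ) where
  contDiff := contDiff_const
  decay := fun _ => ⟨0, fun z => by simp⟩
  decay_fderiv := fun _ => ⟨0, fun z => by simp⟩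

lemma sum {ι : Type*} (s : Finset ι) {F : ι → ℝ × E → ℝ} (hF : ∀ i, RapidC1 (F i)) :
    RapidC1 fun z => ∑ i ∈ s, F i z := by
  classical
  induction s using Finset.induction_on with
  | empty => simpa using zero
  | insert i s hi ih => simpa only [Finset.sum_insert hi] using (hF i).add ih

lemma clm_mul (hF : RapidC1 F) (L : E →L[ℝ] ℝ) : RapidC1 fun z => L z.2 * F z where
  contDiff := (L.contDiff.comp contDiff_snd).mul hF.contDiff
  decay := (hF.decay.norm_snd_mul.const_mul ‖L‖).mono fun z => by
    rw [norm_mul, norm_mul, norm_mul, ← mul_assoc, norm_norm, norm_norm]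
    gcongr
    exact L.le_opNorm _
  decay_fderiv := by
    refine ((hF.decay_fderiv.norm.norm_snd_mul.const_mul ‖L‖).add
      (hF.decay.norm.const_mul ‖L.comp (ContinuousLinearMap.snd ℝ ℝ E)‖)).mono fun z => ?_
    have hL : HasFDerivAt (fun z : ℝ × E => L z.2) (L.comp (ContinuousLinearMap.snd ℝ ℝ E)) z :=
      (L.comp (ContinuousLinearMap.snd ℝ ℝ E)).hasFDerivAt
    rw [(hL.fun_mul (hF.differentiable z).hasFDerivAt).fderiv]
    refine (norm_add_le _ _).trans (le_trans ?_ (le_abs_self _))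
    rw [norm_smul, norm_smul, mul_comm ‖F z‖, ← mul_assoc]
    gcongr
    exact L.le_opNorm _

lemma continuous_fderiv_apply (hF : RapidC1 F) (v : ℝ × E) :
    Continuous fun z => fderiv ℝ F z v :=
  (hF.contDiff.continuous_fderiv one_ne_zero).clm_apply continuous_const

lemma decay_fderiv_apply (hF : RapidC1 F) (v : ℝ × E) : RapidDecay fun z => fderiv ℝ F z v :=
  (hF.decay_fderiv.norm.const_mul ‖v‖).mono fun z => by
    rw [norm_mul, norm_norm, norm_norm, mul_comm]
    exact (fderiv ℝ F z).le_opNorm v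

end Closure

section Integral

variable {E : Type*} [NormedAddCommGroup E] [NormedSpace ℝ E] [FiniteDimensional ℝ E]
  [MeasureSpace E] [BorelSpace E] [(volume : Measure E).IsAddHaarMeasure] {F : ℝ × E → ℝ}

lemma integrable (hF : RapidC1 F) (t : ℝ) : Integrable fun x => F (t, x) := by
  obtain ⟨b, hb, hFb⟩ := hF.decay.exists_integrable_bound
  exact hb.mono' (hF.contDiff.continuous.comp (by fun_prop)).aestronglyMeasurable
    (.of_forall (hFb t))

lemma integrable_fderiv_apply (hF : RapidC1 F) (v : ℝ × E) (t : ℝ) :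
    Integrable fun x => fderiv ℝ F (t, x) v := by
  obtain ⟨b, hb, hFb⟩ := (hF.decay_fderiv_apply v).exists_integrable_bound
  exact hb.mono' ((hF.continuous_fderiv_apply v).comp (by fun_prop)).aestronglyMeasurable
    (.of_forall (hFb t))

lemma hasDerivAt_integral (hF : RapidC1 F) (t : ℝ) :
    HasDerivAt (fun s => ∫ x, F (s, x)) (∫ x, fderiv ℝ F (t, x) (1, 0)) t := by
  obtain ⟨b, hb, hFb⟩ := (hF.decay_fderiv_apply (1, 0)).exists_integrable_bound
  refine (hasDerivAt_integral_of_dominated_loc_of_deriv_le (bound := b) Filter.univ_mem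
    (.of_forall fun s => (hF.integrable s).aestronglyMeasurable) (hF.integrable t)
    (hF.integrable_fderiv_apply (1, 0) t).aestronglyMeasurable
    (.of_forall fun x s _ => hFb s x) hb (.of_forall fun x s _ => ?_)).2
  exact (hF.differentiable (s, x)).hasFDerivAt.comp_hasDerivAt s
    ((hasDerivAt_id s).prodMk (hasDerivAt_const s x))

lemma integral_fderiv_apply_eq_zero (hF : RapidC1 F) (t : ℝ) (v : E) :
    ∫ x, fderiv ℝ F (t, x) (0, v) = 0 := by
  have h := integral_bilinear_hasFDerivAt_right_eq_neg_left_of_integrable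
    (μ := (volume : Measure E)) (B := ContinuousLinearMap.mul ℝ ℝ)
    (f := fun _ => (1 : ℝ)) (f' := fun _ => 0) (g := fun x => F (t, x))
    (g' := fun x => (fderiv ℝ F (t, x)).comp (ContinuousLinearMap.inr ℝ ℝ E)) (v := v)
    (by simp) (by simpa using hF.integrable_fderiv_apply (0, v) t)
    (by simpa using hF.integrable t) (fun x _ => hasFDerivAt_const _ _)
    (fun x _ => (hF.differentiable (t, x)).hasFDerivAt.comp x (hasFDerivAt_prodMk_right t x))
  simpa using h

end Integral

end RapidC1

/-- Twice continuously differentiable functions on spacetime, rapidly decaying with their first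
and second derivatives. -/
structure RapidC2 {E : Type*} [NormedAddCommGroup E] [NormedSpace ℝ E] (F : ℝ × E → ℝ) :
    Prop where
  contDiff : ContDiff ℝ 2 F
  decay : RapidDecay F
  decay_fderiv : RapidDecay (fderiv ℝ F)
  decay_fderiv_fderiv : RapidDecay (fderiv ℝ (fderiv ℝ F))

/-- The derivative of `F` in the direction `v`, as a function of the base point. -/
noncomputable def dirDeriv {E : Type*} [NormedAddCommGroup E] [NormedSpace ℝ E]
    (v : E) (F : E → ℝ) (z : E) : ℝ :=
  fderiv ℝ F z v

namespace RapidC2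

variable {E : Type*} [NormedAddCommGroup E] [NormedSpace ℝ E] {F : ℝ × E → ℝ}

lemma rapidC1 (hF : RapidC2 F) : RapidC1 F where
  contDiff := hF.contDiff.of_le (by norm_num)
  decay := hF.decay
  decay_fderiv := hF.decay_fderiv

lemma contDiff_fderiv (hF : RapidC2 F) : ContDiff ℝ 1 (fderiv ℝ F) :=
  hF.contDiff.fderiv_right (by norm_num)

lemma fderiv_dirDeriv (hF : RapidC2 F) (v z : ℝ × E) :
    fderiv ℝ (dirDeriv v F) z = (fderiv ℝ (fderiv ℝ F) z).flip v := by
  have h := (hF.contDiff_fderiv.differentiable one_ne_zero z).hasFDerivAt.clm_apply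
    (hasFDerivAt_const v z)
  exact h.fderiv.trans (by simp)

lemma dirDeriv (hF : RapidC2 F) (v : ℝ × E) : RapidC1 (dirDeriv v F) where
  contDiff := hF.contDiff_fderiv.clm_apply contDiff_const
  decay := hF.rapidC1.decay_fderiv_apply v
  decay_fderiv := (hF.decay_fderiv_fderiv.norm.const_mul ‖v‖).mono fun z => by
    rw [hF.fderiv_dirDeriv, norm_mul, norm_norm, norm_norm, mul_comm]
    exact ((fderiv ℝ (fderiv ℝ F) z).flip.le_opNorm v).trans (by
      rw [ContinuousLinearMap.opNorm_flip])

lemma dirDeriv_comm (hF : RapidC2 F) (v w z : ℝ × E) :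
    _root_.dirDeriv v (_root_.dirDeriv w F) z = _root_.dirDeriv w (_root_.dirDeriv v F) z := by
  have h := (hF.contDiff.contDiffAt (x := z)).isSymmSndFDerivAt (by simp)
  change fderiv ℝ (_root_.dirDeriv w F) z v = fderiv ℝ (_root_.dirDeriv v F) z w
  rw [hF.fderiv_dirDeriv, hF.fderiv_dirDeriv]
  exact h.eq v w

lemma hasFDerivAt (hF : RapidC2 F) (z : ℝ × E) : HasFDerivAt F (fderiv ℝ F z) z :=
  (hF.rapidC1.differentiable z).hasFDerivAt

lemma hasFDerivAt_dirDeriv (hF : RapidC2 F) (v z : ℝ × E) :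
    HasFDerivAt (_root_.dirDeriv v F) (fderiv ℝ (_root_.dirDeriv v F) z) z :=
  ((hF.dirDeriv v).differentiable z).hasFDerivAt

end RapidC2

section CubicQuintic

variable {n : ℕ}

/-- The time direction in spacetime. -/
def timeDir (n : ℕ) : ℝ × EuclideanSpace ℝ (Fin n) := (1, 0)

/-- The `j`-th coordinate direction in spacetime. -/
noncomputable def spaceDir (j : Fin n) : ℝ × EuclideanSpace ℝ (Fin n) :=
  (0, EuclideanSpace.single j 1)

/-- Real and imaginary parts of a rapidly decaying solution of the cubic-quintic NLS. -/
structure IsRealCQSolution (c d : ℝ) (a b : ℝ × EuclideanSpace ℝ (Fin n) → ℝ) : Prop where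
  re : RapidC2 a
  im : RapidC2 b
  eq_re : ∀ z, -dirDeriv (timeDir n) b z + ∑ j, dirDeriv (spaceDir j) (dirDeriv (spaceDir j) a) z =
    (c * (a z ^ 2 + b z ^ 2) - d * (a z ^ 2 + b z ^ 2) ^ 2) * a z
  eq_im : ∀ z, dirDeriv (timeDir n) a z + ∑ j, dirDeriv (spaceDir j) (dirDeriv (spaceDir j) b) z =
    (c * (a z ^ 2 + b z ^ 2) - d * (a z ^ 2 + b z ^ 2) ^ 2) * b z

variable (c d : ℝ) (a b : ℝ × EuclideanSpace ℝ (Fin n) → ℝ)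

/-- Kinetic energy density. -/
noncomputable def kineticDensity (z : ℝ × EuclideanSpace ℝ (Fin n)) : ℝ :=
  ∑ j, (dirDeriv (spaceDir j) a z ^ 2 + dirDeriv (spaceDir j) b z ^ 2)

/-- Potential energy density. -/
noncomputable def potentialDensity (z : ℝ × EuclideanSpace ℝ (Fin n)) : ℝ :=
  c / 2 * (a z ^ 2 + b z ^ 2) ^ 2 - d / 3 * (a z ^ 2 + b z ^ 2) ^ 3

/-- Energy density. -/
noncomputable def energyDensity (z : ℝ × EuclideanSpace ℝ (Fin n)) : ℝ :=
  kineticDensity a b z + potentialDensity c d a b z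

/-- The `j`-th component of the energy flux. -/
noncomputable def energyFlux (j : Fin n) (z : ℝ × EuclideanSpace ℝ (Fin n)) : ℝ :=
  2 * (dirDeriv (spaceDir j) a z * dirDeriv (timeDir n) a z +
    dirDeriv (spaceDir j) b z * dirDeriv (timeDir n) b z)

/-- Density of the virial function. -/
noncomputable def virialDensity (z : ℝ × EuclideanSpace ℝ (Fin n)) : ℝ :=
  ∑ j, z.2 j * (a z * dirDeriv (spaceDir j) b z - b z * dirDeriv (spaceDir j) a z)

/-- The `k`-th component of the virial flux. -/
noncomputable def virialFlux (k : Fin n) (z : ℝ × EuclideanSpace ℝ (Fin n)) : ℝ :=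
  z.2 k * (a z * dirDeriv (timeDir n) b z - b z * dirDeriv (timeDir n) a z +
      kineticDensity a b z + potentialDensity c d a b z) -
    (n * (a z * dirDeriv (spaceDir k) a z + b z * dirDeriv (spaceDir k) b z) +
      2 * ∑ j, z.2 j * (dirDeriv (spaceDir k) a z * dirDeriv (spaceDir j) a z +
        dirDeriv (spaceDir k) b z * dirDeriv (spaceDir j) b z))

variable {c d a b}

lemma RapidC1.coord_mul {F : ℝ × EuclideanSpace ℝ (Fin n) → ℝ} (hF : RapidC1 F) (j : Fin n) :
    RapidC1 fun z : ℝ × EuclideanSpace ℝ (Fin n) => z.2 j * F z :=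
  hF.clm_mul (EuclideanSpace.proj j)

lemma hasFDerivAt_coord (j : Fin n) (z : ℝ × EuclideanSpace ℝ (Fin n)) :
    HasFDerivAt (fun z : ℝ × EuclideanSpace ℝ (Fin n) => z.2 j)
      ((EuclideanSpace.proj j : EuclideanSpace ℝ (Fin n) →L[ℝ] ℝ).comp
        (ContinuousLinearMap.snd ℝ ℝ _)) z :=
  ((EuclideanSpace.proj j : EuclideanSpace ℝ (Fin n) →L[ℝ] ℝ).comp
    (ContinuousLinearMap.snd ℝ ℝ _)).hasFDerivAt

lemma rapidC1_normSq (ha : RapidC2 a) (hb : RapidC2 b) : RapidC1 fun z => a z ^ 2 + b z ^ 2 :=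
  (ha.rapidC1.pow 1).add (hb.rapidC1.pow 1)

lemma rapidC1_kineticDensity (ha : RapidC2 a) (hb : RapidC2 b) : RapidC1 (kineticDensity a b) :=
  .sum _ fun j => ((ha.dirDeriv (spaceDir j)).pow 1).add ((hb.dirDeriv (spaceDir j)).pow 1)

lemma rapidC1_potentialDensity (ha : RapidC2 a) (hb : RapidC2 b) :
    RapidC1 (potentialDensity c d a b) :=
  (((rapidC1_normSq ha hb).pow 1).const_mul _).sub (((rapidC1_normSq ha hb).pow 2).const_mul _)

lemma rapidC1_energyDensity (ha : RapidC2 a) (hb : RapidC2 b) :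
    RapidC1 (energyDensity c d a b) :=
  (rapidC1_kineticDensity ha hb).add (rapidC1_potentialDensity ha hb)

lemma rapidC1_energyFlux (ha : RapidC2 a) (hb : RapidC2 b) (j : Fin n) :
    RapidC1 (energyFlux a b j) :=
  (((ha.dirDeriv _).mul (ha.dirDeriv _)).add ((hb.dirDeriv _).mul (hb.dirDeriv _))).const_mul _

lemma rapidC1_virialDensity (ha : RapidC2 a) (hb : RapidC2 b) : RapidC1 (virialDensity a b) :=
  .sum _ fun j => ((ha.rapidC1.mul (hb.dirDeriv _)).sub (hb.rapidC1.mul (ha.dirDeriv _))).coord_mul j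

lemma rapidC1_virialFlux (ha : RapidC2 a) (hb : RapidC2 b) (k : Fin n) :
    RapidC1 (virialFlux c d a b k) :=
  (((((ha.rapidC1.mul (hb.dirDeriv _)).sub (hb.rapidC1.mul (ha.dirDeriv _))).add
      (rapidC1_kineticDensity ha hb)).add (rapidC1_potentialDensity ha hb)).coord_mul k).sub
    ((((ha.rapidC1.mul (ha.dirDeriv _)).add (hb.rapidC1.mul (hb.dirDeriv _))).const_mul _).add
      ((RapidC1.sum _ fun j => (((ha.dirDeriv _).mul (ha.dirDeriv _)).add
        ((hb.dirDeriv _).mul (hb.dirDeriv _))).coord_mul j).const_mul _))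

lemma dirDeriv_kineticDensity (ha : RapidC2 a) (hb : RapidC2 b)
    (v z : ℝ × EuclideanSpace ℝ (Fin n)) :
    dirDeriv v (kineticDensity a b) z =
      2 * ∑ j, (dirDeriv (spaceDir j) a z * dirDeriv v (dirDeriv (spaceDir j) a) z +
        dirDeriv (spaceDir j) b z * dirDeriv v (dirDeriv (spaceDir j) b) z) := by
  have h : HasFDerivAt (kineticDensity a b) _ z := HasFDerivAt.fun_sum fun j _ =>
    ((ha.hasFDerivAt_dirDeriv (spaceDir j) z).pow 2).add
      ((hb.hasFDerivAt_dirDeriv (spaceDir j) z).pow 2)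
  rw [dirDeriv, h.fderiv, Finset.mul_sum, sum_apply]
  refine Finset.sum_congr rfl fun j _ => ?_
  simp [dirDeriv]
  ring

lemma dirDeriv_potentialDensity (ha : RapidC2 a) (hb : RapidC2 b)
    (v z : ℝ × EuclideanSpace ℝ (Fin n)) :
    dirDeriv v (potentialDensity c d a b) z =
      2 * (c * (a z ^ 2 + b z ^ 2) - d * (a z ^ 2 + b z ^ 2) ^ 2) *
        (a z * dirDeriv v a z + b z * dirDeriv v b z) := by
  have hr := ((ha.hasFDerivAt z).pow 2).fun_add ((hb.hasFDerivAt z).pow 2)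
  have h : HasFDerivAt (potentialDensity c d a b) _ z :=
    ((hr.pow 2).const_mul (c / 2)).sub ((hr.pow 3).const_mul (d / 3))
  rw [dirDeriv, h.fderiv]
  simp [dirDeriv]
  ring

lemma IsRealCQSolution.dirDeriv_energyDensity (h : IsRealCQSolution c d a b)
    (z : ℝ × EuclideanSpace ℝ (Fin n)) :
    dirDeriv (timeDir n) (energyDensity c d a b) z =
      ∑ j, dirDeriv (spaceDir j) (energyFlux a b j) z := by
  have ha := h.re
  have hb := h.im
  have hF (j : Fin n) : dirDeriv (spaceDir j) (energyFlux a b j) z =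
      2 * (dirDeriv (spaceDir j) (dirDeriv (spaceDir j) a) z * dirDeriv (timeDir n) a z +
        dirDeriv (spaceDir j) (dirDeriv (spaceDir j) b) z * dirDeriv (timeDir n) b z) +
      2 * (dirDeriv (spaceDir j) a z * dirDeriv (timeDir n) (dirDeriv (spaceDir j) a) z +
        dirDeriv (spaceDir j) b z * dirDeriv (timeDir n) (dirDeriv (spaceDir j) b) z) := by
    have hG : HasFDerivAt (energyFlux a b j) _ z :=
      (((ha.hasFDerivAt_dirDeriv (spaceDir j) z).mul (ha.hasFDerivAt_dirDeriv (timeDir n) z)).add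
        ((hb.hasFDerivAt_dirDeriv (spaceDir j) z).mul
          (hb.hasFDerivAt_dirDeriv (timeDir n) z))).const_mul 2
    rw [ha.dirDeriv_comm (timeDir n), hb.dirDeriv_comm (timeDir n), dirDeriv, hG.fderiv]
    simp [dirDeriv]
    ring
  have hE : dirDeriv (timeDir n) (energyDensity c d a b) z =
      dirDeriv (timeDir n) (kineticDensity a b) z +
        dirDeriv (timeDir n) (potentialDensity c d a b) z := by
    have hG : HasFDerivAt (energyDensity c d a b) _ z :=
      ((rapidC1_kineticDensity ha hb).differentiable z).hasFDerivAt.add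
        ((rapidC1_potentialDensity ha hb).differentiable z).hasFDerivAt
    rw [dirDeriv, hG.fderiv]
    rfl
  rw [hE, dirDeriv_kineticDensity ha hb, dirDeriv_potentialDensity ha hb]
  simp only [hF, Finset.sum_add_distrib, ← Finset.mul_sum, ← Finset.sum_mul]
  linear_combination (-2 * dirDeriv (timeDir n) a z) * h.eq_re z +
    (-2 * dirDeriv (timeDir n) b z) * h.eq_im z

lemma dirDeriv_virialDensity (ha : RapidC2 a) (hb : RapidC2 b)
    (z : ℝ × EuclideanSpace ℝ (Fin n)) :
    dirDeriv (timeDir n) (virialDensity a b) z =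
      ∑ j, z.2 j * (dirDeriv (timeDir n) a z * dirDeriv (spaceDir j) b z +
        a z * dirDeriv (timeDir n) (dirDeriv (spaceDir j) b) z -
        (dirDeriv (timeDir n) b z * dirDeriv (spaceDir j) a z +
        b z * dirDeriv (timeDir n) (dirDeriv (spaceDir j) a) z)) := by
  have h : HasFDerivAt (virialDensity a b) _ z := HasFDerivAt.fun_sum fun j _ =>
    (hasFDerivAt_coord j z).mul (((ha.hasFDerivAt z).mul
      (hb.hasFDerivAt_dirDeriv (spaceDir j) z)).sub
      ((hb.hasFDerivAt z).mul (ha.hasFDerivAt_dirDeriv (spaceDir j) z)))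
  rw [dirDeriv, h.fderiv, sum_apply]
  refine Finset.sum_congr rfl fun j _ => ?_
  simp [dirDeriv, timeDir, -mul_eq_mul_left_iff]
  ring

lemma dirDeriv_crossSum (ha : RapidC2 a) (hb : RapidC2 b) (k : Fin n)
    (z : ℝ × EuclideanSpace ℝ (Fin n)) :
    dirDeriv (spaceDir k) (fun z => ∑ j, z.2 j * (dirDeriv (spaceDir k) a z *
        dirDeriv (spaceDir j) a z + dirDeriv (spaceDir k) b z * dirDeriv (spaceDir j) b z)) z =
      dirDeriv (spaceDir k) a z ^ 2 + dirDeriv (spaceDir k) b z ^ 2 +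
      (dirDeriv (spaceDir k) (dirDeriv (spaceDir k) a) z *
          (∑ j, z.2 j * dirDeriv (spaceDir j) a z) +
        dirDeriv (spaceDir k) (dirDeriv (spaceDir k) b) z *
          (∑ j, z.2 j * dirDeriv (spaceDir j) b z)) +
      ∑ j, z.2 j * (dirDeriv (spaceDir k) a z *
          dirDeriv (spaceDir k) (dirDeriv (spaceDir j) a) z +
        dirDeriv (spaceDir k) b z * dirDeriv (spaceDir k) (dirDeriv (spaceDir j) b) z) := by
  have h : HasFDerivAt (fun z : ℝ × EuclideanSpace ℝ (Fin n) =>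
      ∑ j, z.2 j * (dirDeriv (spaceDir k) a z * dirDeriv (spaceDir j) a z +
        dirDeriv (spaceDir k) b z * dirDeriv (spaceDir j) b z)) _ z :=
    HasFDerivAt.fun_sum fun j _ => (hasFDerivAt_coord j z).mul
      (((ha.hasFDerivAt_dirDeriv (spaceDir k) z).mul (ha.hasFDerivAt_dirDeriv (spaceDir j) z)).add
      ((hb.hasFDerivAt_dirDeriv (spaceDir k) z).mul (hb.hasFDerivAt_dirDeriv (spaceDir j) z)))
  have hδ : ∑ j, (dirDeriv (spaceDir k) a z * dirDeriv (spaceDir j) a z +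
      dirDeriv (spaceDir k) b z * dirDeriv (spaceDir j) b z) *
      (EuclideanSpace.single k (1 : ℝ) : EuclideanSpace ℝ (Fin n)) j =
      dirDeriv (spaceDir k) a z ^ 2 + dirDeriv (spaceDir k) b z ^ 2 := by
    simp [pow_two]
  rw [← hδ, Finset.mul_sum, Finset.mul_sum, ← Finset.sum_add_distrib, ← Finset.sum_add_distrib,
    ← Finset.sum_add_distrib]
  conv_lhs => rw [dirDeriv, h.fderiv, sum_apply]
  refine Finset.sum_congr rfl fun j _ => ?_
  simp only [add_apply, smul_apply, smul_eq_mul]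
  simp [dirDeriv, spaceDir]
  ring

lemma dirDeriv_virialFlux (ha : RapidC2 a) (hb : RapidC2 b) (k : Fin n)
    (z : ℝ × EuclideanSpace ℝ (Fin n)) :
    dirDeriv (spaceDir k) (virialFlux c d a b k) z =
      (a z * dirDeriv (timeDir n) b z - b z * dirDeriv (timeDir n) a z +
        kineticDensity a b z + potentialDensity c d a b z) +
      z.2 k * (dirDeriv (timeDir n) b z * dirDeriv (spaceDir k) a z +
        a z * dirDeriv (timeDir n) (dirDeriv (spaceDir k) b) z -
        (dirDeriv (timeDir n) a z * dirDeriv (spaceDir k) b z +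
        b z * dirDeriv (timeDir n) (dirDeriv (spaceDir k) a) z) +
        dirDeriv (spaceDir k) (kineticDensity a b) z +
        dirDeriv (spaceDir k) (potentialDensity c d a b) z) -
      (n * (dirDeriv (spaceDir k) a z ^ 2 + dirDeriv (spaceDir k) b z ^ 2 +
        (a z * dirDeriv (spaceDir k) (dirDeriv (spaceDir k) a) z +
          b z * dirDeriv (spaceDir k) (dirDeriv (spaceDir k) b) z)) +
      2 * (dirDeriv (spaceDir k) a z ^ 2 + dirDeriv (spaceDir k) b z ^ 2) +
      2 * (dirDeriv (spaceDir k) (dirDeriv (spaceDir k) a) z *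
          (∑ j, z.2 j * dirDeriv (spaceDir j) a z) +
        dirDeriv (spaceDir k) (dirDeriv (spaceDir k) b) z *
          (∑ j, z.2 j * dirDeriv (spaceDir j) b z)) +
      2 * ∑ j, z.2 j * (dirDeriv (spaceDir k) a z *
          dirDeriv (spaceDir k) (dirDeriv (spaceDir j) a) z +
        dirDeriv (spaceDir k) b z * dirDeriv (spaceDir k) (dirDeriv (spaceDir j) b) z)) := by
  have hK := ((rapidC1_kineticDensity ha hb).differentiable z).hasFDerivAt
  have hP := ((rapidC1_potentialDensity (c := c) (d := d) ha hb).differentiable z).hasFDerivAt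
  have h1 := (hasFDerivAt_coord k z).mul (((((ha.hasFDerivAt z).mul
    (hb.hasFDerivAt_dirDeriv (timeDir n) z)).sub ((hb.hasFDerivAt z).mul
    (ha.hasFDerivAt_dirDeriv (timeDir n) z))).add hK).add hP)
  have h2 := (((ha.hasFDerivAt z).mul (ha.hasFDerivAt_dirDeriv (spaceDir k) z)).add
    ((hb.hasFDerivAt z).mul (hb.hasFDerivAt_dirDeriv (spaceDir k) z))).const_mul (n : ℝ)
  have h3 := ((RapidC1.sum Finset.univ fun j : Fin n =>
    (((ha.dirDeriv (spaceDir k)).mul (ha.dirDeriv (spaceDir j))).add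
    ((hb.dirDeriv (spaceDir k)).mul (hb.dirDeriv (spaceDir j)))).coord_mul
      j).differentiable z).hasFDerivAt
  have h : HasFDerivAt (virialFlux c d a b k) _ z := h1.sub (h2.add (h3.const_mul 2))
  rw [dirDeriv, h.fderiv]
  simp only [sub_apply, add_apply, smul_apply, smul_eq_mul]
  have hS : fderiv ℝ _ z (spaceDir k) = _ := dirDeriv_crossSum ha hb k z
  rw [hS, ha.dirDeriv_comm (timeDir n),
    hb.dirDeriv_comm (timeDir n)]
  simp [dirDeriv, spaceDir]
  ring

lemma IsRealCQSolution.dirDeriv_virialDensity (h : IsRealCQSolution c d a b)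
    (z : ℝ × EuclideanSpace ℝ (Fin n)) :
    dirDeriv (timeDir n) (virialDensity a b) z =
      ∑ k, dirDeriv (spaceDir k) (virialFlux c d a b k) z + 2 * energyDensity c d a b z +
        c * (n / 2 - 1) * (a z ^ 2 + b z ^ 2) ^ 2 -
        2 * d / 3 * (n - 1) * (a z ^ 2 + b z ^ 2) ^ 3 := by
  have ha := h.re
  have hb := h.im
  have hswap : ∑ k, ∑ j, z.2 j * (dirDeriv (spaceDir k) a z *
        dirDeriv (spaceDir k) (dirDeriv (spaceDir j) a) z +
      dirDeriv (spaceDir k) b z * dirDeriv (spaceDir k) (dirDeriv (spaceDir j) b) z) =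
      ∑ k, z.2 k * ∑ j, (dirDeriv (spaceDir j) a z *
        dirDeriv (spaceDir k) (dirDeriv (spaceDir j) a) z +
      dirDeriv (spaceDir j) b z * dirDeriv (spaceDir k) (dirDeriv (spaceDir j) b) z) := by
    rw [Finset.sum_comm]
    refine Finset.sum_congr rfl fun k _ => ?_
    rw [Finset.mul_sum]
    refine Finset.sum_congr rfl fun j _ => ?_
    rw [ha.dirDeriv_comm (spaceDir j) (spaceDir k), hb.dirDeriv_comm (spaceDir j) (spaceDir k)]
  have hre := h.eq_re z
  have him := h.eq_im z
  have hx (k : Fin n) (r s : ℝ) : z.2 k * (r * s) = r * (z.2 k * s) := mul_left_comm _ _ _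
  simp only [_root_.dirDeriv_virialDensity ha hb, dirDeriv_virialFlux ha hb, energyDensity,
    dirDeriv_kineticDensity ha hb, dirDeriv_potentialDensity ha hb, kineticDensity,
    potentialDensity, hx, Finset.sum_add_distrib, Finset.sum_sub_distrib, mul_add, mul_sub,
    ← Finset.mul_sum, ← Finset.sum_mul, Finset.sum_const, Finset.card_univ, Fintype.card_fin,
    nsmul_eq_mul] at hswap ⊢
  linear_combination (n * a z + 2 * ∑ j, z.2 j * dirDeriv (spaceDir j) a z) * hre +
    (n * b z + 2 * ∑ j, z.2 j * dirDeriv (spaceDir j) b z) * him + 2 * hswap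

lemma RapidC1.integral_dirDeriv_spaceDir {F : ℝ × EuclideanSpace ℝ (Fin n) → ℝ} (hF : RapidC1 F)
    (j : Fin n) (t : ℝ) : ∫ x, dirDeriv (spaceDir j) F (t, x) = 0 :=
  hF.integral_fderiv_apply_eq_zero t _

lemma RapidC1.integrable_dirDeriv {F : ℝ × EuclideanSpace ℝ (Fin n) → ℝ} (hF : RapidC1 F)
    (v : ℝ × EuclideanSpace ℝ (Fin n)) (t : ℝ) : Integrable fun x => dirDeriv v F (t, x) :=
  hF.integrable_fderiv_apply v t

lemma RapidC1.integral_divergence {F : Fin n → ℝ × EuclideanSpace ℝ (Fin n) → ℝ}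
    (hF : ∀ j, RapidC1 (F j)) (t : ℝ) :
    ∫ x, ∑ j, dirDeriv (spaceDir j) (F j) (t, x) = 0 := by
  rw [integral_finsetSum _ fun j _ => (hF j).integrable_dirDeriv _ t]
  exact Finset.sum_eq_zero fun j _ => (hF j).integral_dirDeriv_spaceDir j t

lemma IsRealCQSolution.integral_energyDensity_eq (h : IsRealCQSolution c d a b) (t : ℝ) :
    ∫ x, energyDensity c d a b (t, x) = ∫ x, energyDensity c d a b (0, x) := by
  have hE (s : ℝ) := (rapidC1_energyDensity (c := c) (d := d) h.re h.im).hasDerivAt_integral s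
  refine is_const_of_deriv_eq_zero (fun s => (hE s).differentiableAt) (fun s => ?_) t 0
  rw [(hE s).deriv, ← RapidC1.integral_divergence (rapidC1_energyFlux h.re h.im) s]
  exact integral_congr_ae (.of_forall fun x => h.dirDeriv_energyDensity (s, x))

/-- The virial identity. -/
lemma IsRealCQSolution.hasDerivAt_virial (h : IsRealCQSolution c d a b) (t : ℝ) :
    HasDerivAt (fun s => ∫ x, virialDensity a b (s, x))
      (2 * (∫ x, energyDensity c d a b (0, x)) +
        c * (n / 2 - 1) * (∫ x, (a (t, x) ^ 2 + b (t, x) ^ 2) ^ 2) -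
        2 * d / 3 * (n - 1) * ∫ x, (a (t, x) ^ 2 + b (t, x) ^ 2) ^ 3) t := by
  have hρ := rapidC1_normSq h.re h.im
  have hF := rapidC1_virialFlux (c := c) (d := d) h.re h.im
  have hE := (rapidC1_energyDensity (c := c) (d := d) h.re h.im).integrable t
  have hdiv : Integrable fun x => ∑ k, dirDeriv (spaceDir k) (virialFlux c d a b k) (t, x) :=
    integrable_finsetSum _ fun k _ => (hF k).integrable_dirDeriv _ t
  convert (rapidC1_virialDensity h.re h.im).hasDerivAt_integral t using 1
  calc _ = (∫ x, ∑ k, dirDeriv (spaceDir k) (virialFlux c d a b k) (t, x)) +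
        2 * (∫ x, energyDensity c d a b (t, x)) +
        c * (n / 2 - 1) * (∫ x, (a (t, x) ^ 2 + b (t, x) ^ 2) ^ 2) -
        2 * d / 3 * (n - 1) * ∫ x, (a (t, x) ^ 2 + b (t, x) ^ 2) ^ 3 := by
        rw [RapidC1.integral_divergence hF, zero_add, h.integral_energyDensity_eq t]
    _ = ∫ x, dirDeriv (timeDir n) (virialDensity a b) (t, x) := by
        simp_rw [h.dirDeriv_virialDensity]
        have h2 : Integrable fun x => 2 * energyDensity c d a b (t, x) := hE.const_mul 2
        have h3 : Integrable fun x => c * (n / 2 - 1) * (a (t, x) ^ 2 + b (t, x) ^ 2) ^ 2 :=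
          ((hρ.pow 1).integrable t).const_mul _
        have h4 : Integrable fun x => 2 * d / 3 * (n - 1) * (a (t, x) ^ 2 + b (t, x) ^ 2) ^ 3 :=
          ((hρ.pow 2).integrable t).const_mul _
        have h12 : Integrable fun x => ∑ k, dirDeriv (spaceDir k) (virialFlux c d a b k) (t, x) +
            2 * energyDensity c d a b (t, x) := hdiv.add h2
        have h123 : Integrable fun x => ∑ k, dirDeriv (spaceDir k) (virialFlux c d a b k) (t, x) +
            2 * energyDensity c d a b (t, x) +
            c * (n / 2 - 1) * (a (t, x) ^ 2 + b (t, x) ^ 2) ^ 2 := h12.add h3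
        rw [integral_sub h123 h4, integral_add h12 h3, integral_add hdiv h2]
        simp only [integral_const_mul]

lemma Function.Periodic.eq_zero_of_hasDerivAt_nonpos {f f' : ℝ → ℝ} {T : ℝ}
    (hf : Function.Periodic f T) (hT : 0 < T) (hf' : ∀ t, HasDerivAt f (f' t) t)
    (hle : ∀ t, f' t ≤ 0) (t : ℝ) : f' t = 0 := by
  have hanti : Antitone f := antitone_of_deriv_nonpos (fun s => (hf' s).differentiableAt)
    fun s => (hf' s).deriv ▸ hle s
  have hconst (s : ℝ) : f s = f 0 := by
    obtain ⟨y, hy, hys⟩ := hf.exists_mem_Ico₀ hT s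
    rw [hys]
    refine le_antisymm (hanti hy.1) ?_
    rw [← hf 0]
    exact hanti (by linarith [hy.2])
  have h0 : HasDerivAt f 0 t := by
    rw [funext hconst]
    exact hasDerivAt_const t _
  exact (hf' t).unique h0

lemma RapidC1.eq_zero_of_integral_nonpos {F : ℝ × EuclideanSpace ℝ (Fin n) → ℝ} (hF : RapidC1 F)
    (hnn : ∀ z, 0 ≤ F z) {t : ℝ} (hint : ∫ x, F (t, x) ≤ 0) (x : EuclideanSpace ℝ (Fin n)) :
    F (t, x) = 0 := by
  have hc : Continuous fun x => F (t, x) := hF.contDiff.continuous.comp (by fun_prop)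
  have h0 := (integral_eq_zero_iff_of_nonneg (fun x => hnn (t, x)) (hF.integrable t)).1
    (le_antisymm hint (integral_nonneg fun x => hnn (t, x)))
  exact congrFun ((hc.ae_eq_iff_eq volume continuous_const).1 h0) x

/-- Rapidly decaying time-periodic solutions vanish in the two sign regimes. -/
theorem IsRealCQSolution.eq_zero_of_periodic (h : IsRealCQSolution c d a b) (hcd : 0 < c * d)
    {T : ℝ} (hT : 0 < T) (hP : Function.Periodic (fun t => ∫ x, virialDensity a b (t, x)) T)
    (hreg : (n = 1 ∧ c * (∫ x, energyDensity c d a b (0, x)) ≤ 0) ∨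
      (n = 2 ∧ d * (∫ x, energyDensity c d a b (0, x)) ≤ 0))
    (t : ℝ) (x : EuclideanSpace ℝ (Fin n)) : a (t, x) ^ 2 + b (t, x) ^ 2 = 0 := by
  have hc : c ≠ 0 := left_ne_zero_of_mul hcd.ne'
  have hd : d ≠ 0 := right_ne_zero_of_mul hcd.ne'
  have hρ := rapidC1_normSq h.re h.im
  rcases hreg with ⟨hn, hE⟩ | ⟨hn, hE⟩
  · have hnn (s : ℝ) : 0 ≤ ∫ x, (a (s, x) ^ 2 + b (s, x) ^ 2) ^ 2 :=
      integral_nonneg fun x => by positivity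
    have hn' : (n : ℝ) = 1 := by exact_mod_cast hn
    have hcc : 0 < c ^ 2 := by positivity
    have hQ : Function.Periodic (fun t => c * ∫ x, virialDensity a b (t, x)) T :=
      fun s => congrArg (c * ·) (hP s)
    have key := hQ.eq_zero_of_hasDerivAt_nonpos hT
      (fun s => (h.hasDerivAt_virial s).const_mul c) (fun s => by
        rw [hn']; nlinarith [mul_nonneg hcc.le (hnn s)]) t
    rw [hn'] at key
    refine pow_eq_zero_iff two_ne_zero |>.1 <|
      (hρ.pow 1).eq_zero_of_integral_nonpos (fun z => by positivity) ?_ x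
    change ∫ x, (a (t, x) ^ 2 + b (t, x) ^ 2) ^ 2 ≤ 0
    by_contra! hpos
    nlinarith [mul_pos hcc hpos]
  · have hnn (s : ℝ) : 0 ≤ ∫ x, (a (s, x) ^ 2 + b (s, x) ^ 2) ^ 3 :=
      integral_nonneg fun x => by positivity
    have hn' : (n : ℝ) = 2 := by exact_mod_cast hn
    have hdd : 0 < d ^ 2 := by positivity
    have hQ : Function.Periodic (fun t => d * ∫ x, virialDensity a b (t, x)) T :=
      fun s => congrArg (d * ·) (hP s)
    have key := hQ.eq_zero_of_hasDerivAt_nonpos hT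
      (fun s => (h.hasDerivAt_virial s).const_mul d) (fun s => by
        rw [hn']; nlinarith [mul_nonneg hdd.le (hnn s)]) t
    rw [hn'] at key
    refine pow_eq_zero_iff three_ne_zero |>.1 <|
      (hρ.pow 2).eq_zero_of_integral_nonpos (fun z => by positivity) ?_ x
    change ∫ x, (a (t, x) ^ 2 + b (t, x) ^ 2) ^ 3 ≤ 0
    by_contra! hpos
    nlinarith [mul_pos hdd hpos]

end CubicQuintic

section ComplexToReal

variable {E : Type*} [NormedAddCommGroup E] [NormedSpace ℝ E] {n : ℕ}

lemma dirDeriv_clm_comp {G : E → ℂ} {z : E} (hG : DifferentiableAt ℝ G z) (L : ℂ →L[ℝ] ℝ) (v : E) :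
    dirDeriv v (fun y => L (G y)) z = L (fderiv ℝ G z v) := by
  have h : HasFDerivAt (fun y => L (G y)) _ z := L.hasFDerivAt.comp z hG.hasFDerivAt
  rw [dirDeriv, h.fderiv]
  rfl

lemma rapidC2_clm_comp {w : ℝ × E → ℂ} (hw : ContDiff ℝ 2 w) {C γ : ℝ} (hγ : 0 < γ)
    (hloc : ∀ k : ℕ, k ≤ 2 → ∀ z, ‖iteratedFDeriv ℝ k w z‖ ≤ C * Real.exp (-γ * ‖z.2‖))
    (L : ℂ →L[ℝ] ℝ) : RapidC2 fun z => L (w z) := by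
  have hdec (k : ℕ) (hk : k ≤ 2) : RapidDecay (iteratedFDeriv ℝ k fun z => L (w z)) := by
    refine ((RapidDecay.of_exp_bound hγ (hloc k hk)).norm.const_mul ‖L‖).mono fun z => ?_
    rw [norm_mul, norm_norm, norm_norm]
    exact L.norm_iteratedFDeriv_comp_left hw.contDiffAt (by exact_mod_cast hk)
  exact {
    contDiff := L.contDiff.comp hw
    decay := (hdec 0 (by norm_num)).mono fun z => by rw [norm_iteratedFDeriv_zero]
    decay_fderiv := (hdec 1 (by norm_num)).mono fun z => by rw [norm_iteratedFDeriv_one]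
    decay_fderiv_fderiv := (hdec 2 le_rfl).mono fun z => by
      rw [← norm_iteratedFDeriv_one, norm_iteratedFDeriv_fderiv] }

lemma pd_slice {G : ℝ × EuclideanSpace ℝ (Fin n) → ℂ} (hG : Differentiable ℝ G) (j : Fin n)
    (t : ℝ) (x : EuclideanSpace ℝ (Fin n)) :
    pd (fun y => G (t, y)) j x = fderiv ℝ G (t, x) (spaceDir j) := by
  have h : HasFDerivAt (fun y => G (t, y)) _ x :=
    (hG (t, x)).hasFDerivAt.comp x (hasFDerivAt_prodMk_right t x)
  rw [pd, h.fderiv]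
  rfl

lemma deriv_slice {G : ℝ × EuclideanSpace ℝ (Fin n) → ℂ} (hG : Differentiable ℝ G)
    (t : ℝ) (x : EuclideanSpace ℝ (Fin n)) :
    deriv (fun s => G (s, x)) t = fderiv ℝ G (t, x) (timeDir n) :=
  ((hG (t, x)).hasFDerivAt.comp_hasDerivAt t
    ((hasDerivAt_id t).prodMk (hasDerivAt_const t x))).deriv

lemma clm_lap_slice {w : ℝ × EuclideanSpace ℝ (Fin n) → ℂ} (hw : ContDiff ℝ 2 w) (L : ℂ →L[ℝ] ℝ)
    (t : ℝ) (x : EuclideanSpace ℝ (Fin n)) :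
    L (lap (fun y => w (t, y)) x) =
      ∑ j, dirDeriv (spaceDir j) (dirDeriv (spaceDir j) fun z => L (w z)) (t, x) := by
  have hd : Differentiable ℝ w := hw.differentiable two_ne_zero
  rw [lap, map_sum]
  refine Finset.sum_congr rfl fun j _ => ?_
  have hG : Differentiable ℝ fun z => fderiv ℝ w z (spaceDir j) :=
    ((hw.fderiv_right (m := 1) (by norm_num)).clm_apply contDiff_const).differentiable one_ne_zero
  have h1 : (dirDeriv (spaceDir j) fun z => L (w z)) = fun z => L (fderiv ℝ w z (spaceDir j)) :=
    funext fun z => dirDeriv_clm_comp (hd z) L _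
  rw [h1, dirDeriv_clm_comp (hG _), ← pd_slice hG]
  simp only [pd_slice hd]

lemma isRealCQSolution_re_im {lam1 lam2 : ℝ} {w : ℝ × EuclideanSpace ℝ (Fin n) → ℂ}
    (hw : ContDiff ℝ 2 w) {C γ : ℝ} (hγ : 0 < γ)
    (hloc : ∀ k : ℕ, k ≤ 2 → ∀ z, ‖iteratedFDeriv ℝ k w z‖ ≤ C * Real.exp (-γ * ‖z.2‖))
    (heq : ∀ t x, Complex.I * deriv (fun s => w (s, x)) t + lap (fun y => w (t, y)) x
      = ((lam1 * ‖w (t, x)‖ ^ 2 - lam2 * ‖w (t, x)‖ ^ 4 : ℝ) : ℂ) * w (t, x)) :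
    IsRealCQSolution lam1 lam2 (fun z => Complex.reCLM (w z)) (fun z => Complex.imCLM (w z)) := by
  have hd : Differentiable ℝ w := hw.differentiable two_ne_zero
  have hnorm (z) : ‖w z‖ ^ 2 = (w z).re ^ 2 + (w z).im ^ 2 := by
    rw [Complex.sq_norm, Complex.normSq_apply]
    ring
  have hnorm4 (z) : ‖w z‖ ^ 4 = ((w z).re ^ 2 + (w z).im ^ 2) ^ 2 := by
    rw [← hnorm]
    ring
  refine ⟨rapidC2_clm_comp hw hγ hloc _, rapidC2_clm_comp hw hγ hloc _, ?_, ?_⟩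
  · rintro ⟨t, x⟩
    rw [← clm_lap_slice hw, dirDeriv_clm_comp (hd _), ← deriv_slice hd]
    have h := congrArg Complex.re (heq t x)
    rw [hnorm, hnorm4, Complex.re_ofReal_mul, Complex.add_re, Complex.I_mul_re] at h
    exact h
  · rintro ⟨t, x⟩
    rw [← clm_lap_slice hw, dirDeriv_clm_comp (hd _), ← deriv_slice hd]
    have h := congrArg Complex.im (heq t x)
    rw [hnorm, hnorm4, Complex.im_ofReal_mul, Complex.add_im, Complex.I_mul_im] at h
    exact h

lemma energyCQ_eq_integral_energyDensity {lam1 lam2 : ℝ}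
    {u : ℝ → EuclideanSpace ℝ (Fin n) → ℂ} (hu : Differentiable ℝ (Function.uncurry u)) :
    energyCQ lam1 lam2 u = ∫ x, energyDensity lam1 lam2
      (fun z => Complex.reCLM (Function.uncurry u z))
      (fun z => Complex.imCLM (Function.uncurry u z)) (0, x) := by
  refine integral_congr_ae (.of_forall fun x => ?_)
  have hsq (z : ℂ) : ‖z‖ ^ 2 = z.re ^ 2 + z.im ^ 2 := by
    rw [Complex.sq_norm, Complex.normSq_apply]
    ring
  have h4 (z : ℂ) : ‖z‖ ^ 4 = (‖z‖ ^ 2) ^ 2 := by ring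
  have h6 (z : ℂ) : ‖z‖ ^ 6 = (‖z‖ ^ 2) ^ 3 := by ring
  have hpd (j : Fin n) : pd (u 0) j x = _ := pd_slice hu j 0 x
  simp only [energyDensity, kineticDensity, potentialDensity, dirDeriv_clm_comp (hu _)]
  simp only [hpd, h4, h6, hsq, Complex.reCLM_apply, Complex.imCLM_apply,
    Function.uncurry_apply_pair]
  ring

end ComplexToReal

/-- **Nonexistence of breathers for the cubic-quintic NLS in dimensions 1 and 2.**
A smooth, exponentially localized, time-periodic solution of
`i ∂ₜ u + Δ u = λ₁|u|²u - λ₂|u|⁴u` (with `λ₁λ₂ > 0`) having zero momentum and lying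
in the regimes (1) `n = 1`, `λ₁ E₁[u] ≤ 0` or (2) `n = 2`, `λ₂ E₁[u] ≤ 0` is
identically zero. -/
theorem no_cubic_quintic_breather_low_dim (n : ℕ) (lam1 lam2 : ℝ)
    (hll : 0 < lam1 * lam2)
    (u : ℝ → EuclideanSpace ℝ (Fin n) → ℂ)
    (hsmooth : ContDiff ℝ (⊤ : ℕ∞) (Function.uncurry u))
    (heq : ∀ (t : ℝ) (x : EuclideanSpace ℝ (Fin n)),
      Complex.I * deriv (fun s => u s x) t + lap (u t) x
        = ((lam1 * ‖u t x‖ ^ 2 - lam2 * ‖u t x‖ ^ 4 : ℝ) : ℂ) * u t x)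
    (hloc : ∃ C > 0, ∃ γ > 0, ∀ k : ℕ, k ≤ 2 → ∀ (t : ℝ) (x : EuclideanSpace ℝ (Fin n)),
      ‖iteratedFDeriv ℝ k (Function.uncurry u) (t, x)‖ ≤ C * Real.exp (-γ * ‖x‖))
    (hper : ∃ T > 0, ∀ (t : ℝ) (x : EuclideanSpace ℝ (Fin n)), u (t + T) x = u t x)
    (hmom : ∀ j : Fin n, (∫ x, pd (u 0) j x * (starRingEnd ℂ) (u 0 x)).im = 0)
    (hreg : (n = 1 ∧ lam1 * energyCQ lam1 lam2 u ≤ 0) ∨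
            (n = 2 ∧ lam2 * energyCQ lam1 lam2 u ≤ 0)) :
    ∀ t x, u t x = 0 := by
  obtain ⟨C, -, γ, hγ, hloc⟩ := hloc
  obtain ⟨T, hT, hper⟩ := hper
  have hu : ContDiff ℝ 2 (Function.uncurry u) := contDiff_infty.1 hsmooth 2
  have hd : Differentiable ℝ (Function.uncurry u) := hu.differentiable two_ne_zero
  have h := isRealCQSolution_re_im hu hγ (fun k hk z => hloc k hk z.1 z.2) heq
  have hvir : Function.Periodic (fun t => ∫ x, virialDensity
      (fun z => Complex.reCLM (Function.uncurry u z))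
      (fun z => Complex.imCLM (Function.uncurry u z)) (t, x)) T := fun t => by
    have hut : u (t + T) = u t := funext (hper t)
    have hpd (s : ℝ) (j : Fin n) (x) :
        fderiv ℝ (Function.uncurry u) (s, x) (spaceDir j) = pd (u s) j x := (pd_slice hd j s x).symm
    simp only [virialDensity, dirDeriv_clm_comp (hd _), hpd, Function.uncurry_apply_pair, hut]
  intro t x
  rw [energyCQ_eq_integral_energyDensity hd] at hreg
  have h0 := h.eq_zero_of_periodic hll hT hvir hreg t x
  rw [← norm_eq_zero, ← sq_eq_zero_iff, Complex.sq_norm, Complex.normSq_apply, ← h0]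
  simp only [Complex.reCLM_apply, Complex.imCLM_apply, Function.uncurry_apply_pair]
  ring
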